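/- arXiv:2402.00719 — 6 statements merged into one kernel-verified Lean document; each statement's English description precedes it below -/
import Mathlib

section
/- The smoothed Heaviside step function H is twice continuously differentiable on ℝ. -/
/-- The smoothed Heaviside step function `H`. -/
noncomputable def smoothHeaviside (z : ℝ) : ℝ :=
  if z < -3 then 0
  else if z < -2 then (3 + z)^3 / 6
  else if z < -1 then (3 - 9*z - 9*z^2 - 2*z^3) / 6
  else if z < 0 then 1 + z^3 / 6
  else 1

theorem hasDerivAt_max_zero_pow (n : ℕ) (x : ℝ) :
    HasDerivAt (fun z : ℝ => max z 0 ^ (n + 2)) ((n + 2) * max x 0 ^ (n + 1)) x := by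
  have hpow : HasDerivAt (fun z : ℝ => z ^ (n + 2)) ((n + 2) * x ^ (n + 1)) x := by
    simpa using hasDerivAt_pow (n + 2) x
  rcases lt_trichotomy x 0 with hx | rfl | hx
  · rw [max_eq_right hx.le, zero_pow n.succ_ne_zero, mul_zero]
    refine (hasDerivAt_const x (0 : ℝ)).congr_of_eventuallyEq ?_
    filter_upwards [Iio_mem_nhds hx] with z hz
    simp [max_eq_right (Set.mem_Iio.1 hz).le]
  · rw [max_self, ← hasDerivWithinAt_univ, ← Set.Iic_union_Ici (a := (0 : ℝ))]
    refine HasDerivWithinAt.union ?_ ?_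
    · rw [zero_pow n.succ_ne_zero, mul_zero]
      refine (hasDerivWithinAt_const (0 : ℝ) _ (0 : ℝ)).congr (fun z hz => ?_) (by simp)
      simp [max_eq_right (Set.mem_Iic.1 hz)]
    · refine hpow.hasDerivWithinAt.congr (fun z hz => ?_) (by simp)
      simp [max_eq_left (Set.mem_Ici.1 hz)]
  · rw [max_eq_left hx.le]
    refine hpow.congr_of_eventuallyEq ?_
    filter_upwards [Ioi_mem_nhds hx] with z hz
    simp [max_eq_left (Set.mem_Ioi.1 hz).le]

theorem contDiff_max_zero_pow (n : ℕ) :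
    ContDiff ℝ n (fun z : ℝ => max z 0 ^ (n + 1)) := by
  induction n with
  | zero => exact contDiff_zero.2 (by fun_prop)
  | succ n ih =>
    have hderiv := hasDerivAt_max_zero_pow n
    rw [Nat.cast_succ, contDiff_succ_iff_deriv]
    refine ⟨fun x => (hderiv x).differentiableAt, by simp, ?_⟩
    rw [show deriv (fun z : ℝ => max z 0 ^ (n + 1 + 1)) = _ from
      funext fun x => (hderiv x).deriv]
    exact contDiff_const.mul ih

/-- `H` is a linear combination of truncated cubes, i.e. the integral of a quadratic B-spline. -/
theorem smoothHeaviside_eq_truncated_cubes (z : ℝ) :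
    smoothHeaviside z = (max (z + 3) 0 ^ 3 - 3 * max (z + 2) 0 ^ 3
      + 3 * max (z + 1) 0 ^ 3 - max z 0 ^ 3) / 6 := by
  unfold smoothHeaviside
  split_ifs
  · rw [max_eq_right, max_eq_right, max_eq_right, max_eq_right] <;> linarith
  · rw [max_eq_left, max_eq_right, max_eq_right, max_eq_right] <;> linarith
  · rw [max_eq_left, max_eq_left, max_eq_right, max_eq_right] <;> linarith
  · rw [max_eq_left, max_eq_left, max_eq_left, max_eq_right] <;> linarith
  · rw [max_eq_left, max_eq_left, max_eq_left, max_eq_left] <;> linarith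

/-- The smoothed Heaviside step function `H` is twice continuously differentiable on `ℝ`. -/
theorem smoothHeaviside_contDiff : ContDiff ℝ 2 smoothHeaviside := by
  have hcube : ContDiff ℝ 2 (fun z : ℝ => max z 0 ^ 3) := contDiff_max_zero_pow 2
  have hshift (a : ℝ) : ContDiff ℝ 2 (fun z : ℝ => max (z + a) 0 ^ 3) :=
    hcube.comp (contDiff_id.add contDiff_const)
  rw [funext smoothHeaviside_eq_truncated_cubes]
  exact ((((hshift 3).sub (contDiff_const.mul (hshift 2))).add
    (contDiff_const.mul (hshift 1))).sub hcube).div_const 6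
end

section
/- For every ε > 0 and every natural number p ≥ 1, the barrier function p_ε(z) := h_ε(z)/z^p is antitone (monotonically nonincreasing) on (0, ∞); this is the repulsiveness property required of the pointwise contact potential. -/
/-- The cubic B-spline basis function `B³`. -/
noncomputable def cubicBSpline (v : ℝ) : ℝ :=
  if |v| < 1 then 2/3 - v^2 + |v|^3/2
  else if |v| < 2 then (2 - |v|)^3/6
  else 0

/-- The localization function `h_ε(z) = (3/2) ⬝ B³(2z/ε)`. -/
noncomputable def localization (ε z : ℝ) : ℝ := (3/2) * cubicBSpline (2 * z / ε)

/-- The barrier function `p_ε(z) = h_ε(z) / z^p`. -/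
noncomputable def barrier (ε : ℝ) (p : ℕ) (z : ℝ) : ℝ := localization ε z / z ^ p

theorem cubicBSpline_nonneg (v : ℝ) : 0 ≤ cubicBSpline v := by
  have h0 := abs_nonneg v
  unfold cubicBSpline
  rw [← sq_abs]
  split_ifs with h1 h2
  · nlinarith [pow_nonneg h0 3]
  · have : 0 ≤ 2 - |v| := by linarith
    positivity
  · exact le_rfl

theorem cubicBSpline_antitoneOn : AntitoneOn cubicBSpline (Set.Ici 0) := by
  intro a ha b hb hab
  have ha : 0 ≤ a := ha
  have hb : 0 ≤ b := hb
  by_cases hb2 : b < 2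
  swap
  · have : cubicBSpline b = 0 := by
      unfold cubicBSpline
      rw [abs_of_nonneg hb, if_neg (by linarith), if_neg hb2]
    exact this ▸ cubicBSpline_nonneg a
  have ha2 : a < 2 := by linarith
  unfold cubicBSpline
  rw [abs_of_nonneg ha, abs_of_nonneg hb, if_pos hb2, if_pos ha2]
  split_ifs with hb1 ha1 ha1
  · have : 0 ≤ (b - a) * (b + a - (b ^ 2 + a * b + a ^ 2) / 2) :=
      mul_nonneg (by linarith) (by nlinarith)
    linarith
  · linarith
  · have h1 : (2 - b) ^ 3 ≤ 1 := pow_le_one₀ (by linarith) (by linarith)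
    have h2 : 0 ≤ (1 - a) * (1 + a - a ^ 2) := mul_nonneg (by linarith) (by nlinarith)
    linarith
  · have : (2 - b) ^ 3 ≤ (2 - a) ^ 3 := pow_le_pow_left₀ (by linarith) (by linarith) 3
    linarith

/-- For every `ε > 0` and natural number `p ≥ 1`, the barrier function
`p_ε(z) = h_ε(z) / z^p` is antitone (monotonically nonincreasing) on `(0, ∞)`. -/
theorem barrier_antitoneOn (ε : ℝ) (hε : 0 < ε) (p : ℕ) (hp : 1 ≤ p) :
    AntitoneOn (barrier ε p) (Set.Ioi 0) := by
  intro a ha b hb hab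
  have ha : 0 < a := ha
  have hb : 0 < b := hb
  have hB : cubicBSpline (2 * b / ε) ≤ cubicBSpline (2 * a / ε) :=
    cubicBSpline_antitoneOn (Set.mem_Ici.2 (by positivity)) (Set.mem_Ici.2 (by positivity))
      (by gcongr)
  have h0 := cubicBSpline_nonneg (2 * a / ε)
  unfold barrier localization
  gcongr
end

section
/- For every ε > 0 and every natural number p ≥ 1, the barrier function z ↦ h_ε(z)/z^p is not Lebesgue integrable on the interval (0, ε); i.e., its integral over the surface is not finite as the distance goes to zero. (This is the property that distinguishes the paper's barrier from the Convergent IPC barrier, whose potential integral remains finite at zero distance.) -/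
open MeasureTheory

theorem one_sixth_le_cubicBSpline {v : ℝ} (hv₀ : 0 ≤ v) (hv₁ : v < 1) :
    1 / 6 ≤ cubicBSpline v := by
  rw [cubicBSpline, abs_of_nonneg hv₀, if_pos hv₁]
  nlinarith [mul_nonneg (sub_nonneg.2 hv₁.le)
    (add_nonneg zero_le_one (mul_nonneg hv₀ (sub_nonneg.2 hv₁.le)))]

/-- Near zero the barrier dominates a multiple of `z⁻¹`. -/
theorem inv_le_four_mul_barrier {ε z : ℝ} {p : ℕ} (hp : 1 ≤ p) (hz : 0 < z) (hz₁ : z ≤ 1)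
    (hzε : z < ε / 2) : z⁻¹ ≤ 4 * barrier ε p z := by
  have hε : 0 < ε := by linarith
  have h : 1 / 6 ≤ cubicBSpline (2 * z / ε) :=
    one_sixth_le_cubicBSpline (by positivity) (by rw [div_lt_one hε]; linarith)
  have hpow : z ^ p ≤ z := pow_le_of_le_one hz.le hz₁ (by omega)
  have hinv : z⁻¹ ≤ (z ^ p)⁻¹ := inv_anti₀ (by positivity) hpow
  have hpos : 0 < (z ^ p)⁻¹ := by positivity
  rw [barrier, localization, div_eq_mul_inv]
  nlinarith

/-- For every `ε > 0` and natural number `p ≥ 1`, the barrier function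
`z ↦ h_ε(z) / z^p` is not Lebesgue integrable on the interval `(0, ε)`. -/
theorem barrier_not_integrableOn (ε : ℝ) (hε : 0 < ε) (p : ℕ) (hp : 1 ≤ p) :
    ¬ IntegrableOn (barrier ε p) (Set.Ioo 0 ε) volume := by
  intro h
  obtain ⟨δ, hδ, hδ'⟩ := exists_between (lt_min one_pos (half_pos hε))
  obtain ⟨hδ₁, hδε⟩ := lt_min_iff.1 hδ'
  have hsub : Set.Ioo 0 δ ⊆ Set.Ioo 0 ε := Set.Ioo_subset_Ioo_right (by linarith)
  have hinv : IntegrableOn (fun z : ℝ ↦ z⁻¹) (Set.Ioo 0 δ) volume := by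
    refine ((h.mono_set hsub).const_mul 4).mono' (by fun_prop) ?_
    refine (ae_restrict_iff' measurableSet_Ioo).2 (.of_forall fun z hz ↦ ?_)
    rw [Real.norm_of_nonneg (inv_nonneg.2 hz.1.le)]
    exact inv_le_four_mul_barrier hp hz.1 (hz.2.trans hδ₁).le (hz.2.trans hδε)
  have hint : IntervalIntegrable (fun z : ℝ ↦ z⁻¹) volume 0 δ :=
    (intervalIntegrable_iff_integrableOn_Ioo_of_le hδ.le).2 hinv
  rcases intervalIntegrable_inv_iff.1 hint with h₀ | h₀
  · exact hδ.ne h₀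
  · exact h₀ Set.left_mem_uIcc
end

section
/- For every angle θ ∈ (0, π), the function (s, t) ↦ (s² + t² − 2st·cos θ)^{−1/2} is Lebesgue integrable on the open square (0, 1) × (0, 1). This establishes the Finiteness requirement for the barrier power p = n − 1 = 1 in dimension n = 2 at a piecewise-smooth corner: the double integral of the inverse first power of the distance over two sides of a corner is finite. -/
open MeasureTheory

/-- For every angle `θ ∈ (0, π)`, the function
`(s, t) ↦ (s² + t² − 2st·cos θ)^(−1/2)` is Lebesgue integrable on `(0,1) × (0,1)`:
the double integral of the inverse first power of the distance over two sides of a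
corner is finite. -/
theorem corner_inv_distance_integrable (θ : ℝ) (hθ : θ ∈ Set.Ioo 0 Real.pi) :
    IntegrableOn
      (fun p : ℝ × ℝ =>
        (p.1 ^ 2 + p.2 ^ 2 - 2 * p.1 * p.2 * Real.cos θ) ^ (-(1:ℝ)/2))
      (Set.Ioo (0:ℝ) 1 ×ˢ Set.Ioo (0:ℝ) 1) volume := by
  have hc : 0 < 2 * (1 - Real.cos θ) := by
    have := Real.cos_lt_cos_of_nonneg_of_le_pi le_rfl hθ.2.le hθ.1
    rw [Real.cos_zero] at this
    linarith
  have hpow : IntegrableOn (fun x : ℝ => x ^ (-(1:ℝ)/2)) (Set.Ioo 0 1) volume :=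
    (intervalIntegral.integrableOn_Ioo_rpow_iff one_pos).2 (by norm_num)
  have hprod := (hpow.integrable.mul_prod hpow.integrable).const_mul
    ((2 * (1 - Real.cos θ)) ^ (-(1:ℝ)/2))
  rw [Measure.prod_restrict, ← Measure.volume_eq_prod] at hprod
  refine hprod.mono' (Measurable.aestronglyMeasurable (by fun_prop)) ?_
  filter_upwards [ae_restrict_mem (measurableSet_Ioo.prod measurableSet_Ioo)] with p hp
  obtain ⟨⟨hs, -⟩, ⟨ht, -⟩⟩ := hp
  -- The squared distance is `(s - t)² + 2(1 - cos θ)st`.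
  have hle : 2 * (1 - Real.cos θ) * (p.1 * p.2) ≤
      p.1 ^ 2 + p.2 ^ 2 - 2 * p.1 * p.2 * Real.cos θ := by
    linarith [sq_nonneg (p.1 - p.2)]
  have hpos : 0 < 2 * (1 - Real.cos θ) * (p.1 * p.2) := by positivity
  rw [Real.norm_of_nonneg (Real.rpow_nonneg (hpos.le.trans hle) _),
    ← Real.mul_rpow hs.le ht.le, ← Real.mul_rpow hc.le (mul_pos hs ht).le]
  exact Real.rpow_le_rpow_of_nonpos hpos hle (by norm_num)
end

section
/- Let V, A, B ∈ ℝ² be affinely independent points, let T be the convex hull of {V, A, B}, and let P ∈ ℝ². If the segment [V, P] intersects T in some point other than V, then either P ∈ T or the segment [V, P] intersects the segment [A, B]. (Consequently, on a piecewise linear mesh, if an element adjacent to a vertex V is in contact with an edge through V, then some non-adjacent element pair is in contact, so the contact potential may safely exclude adjacent element pairs without violating the barrier requirement.) -/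
/-- If two segments issuing from `v` share a point other than `v`, then one of them contains the
far endpoint of the other. -/
theorem mem_segment_or_mem_segment_of_ne_left {𝕜 E : Type*} [Field 𝕜] [LinearOrder 𝕜]
    [IsStrictOrderedRing 𝕜] [AddCommGroup E] [Module 𝕜 E] {v p q x : E}
    (hp : x ∈ segment 𝕜 v p) (hq : x ∈ segment 𝕜 v q) (hx : x ≠ v) :
    p ∈ segment 𝕜 v q ∨ q ∈ segment 𝕜 v p := by
  wlog hle : ∃ s t : 𝕜, 0 ≤ s ∧ s ≤ t ∧ v + t • (p - v) = x ∧ v + s • (q - v) = x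
    generalizing p q
  · rw [or_comm]
    refine this hq hp ?_
    rw [segment_eq_image'] at hp hq
    obtain ⟨t, ht, htx⟩ := hp
    obtain ⟨s, hs, hsx⟩ := hq
    rcases le_total s t with hst | hts
    · exact absurd ⟨s, t, hs.1, hst, htx, hsx⟩ hle
    · exact ⟨t, s, ht.1, hts, hsx, htx⟩
  · obtain ⟨s, t, hs, hst, htx, hsx⟩ := hle
    have ht : t ≠ 0 := by
      rintro rfl
      exact hx (by simpa using htx.symm)
    left
    rw [segment_eq_image']
    refine ⟨s / t, ⟨div_nonneg hs (hs.trans hst), div_le_one_of_le₀ hst (hs.trans hst)⟩, ?_⟩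
    have hdir : s • (q - v) = t • (p - v) := add_left_cancel (hsx.trans htx.symm)
    simp only [div_eq_inv_mul, mul_smul, hdir]
    rw [inv_smul_smul₀ ht, add_sub_cancel]

/-- Let `V, A, B ∈ ℝ²` be affinely independent, `T = conv{V, A, B}`, and `P ∈ ℝ²`.
If the segment `[V, P]` meets `T` in a point other than `V`, then either `P ∈ T` or
the segment `[V, P]` meets the segment `[A, B]`. -/
theorem adjacent_exclusion_triangle (V A B P : EuclideanSpace ℝ (Fin 2))
    (hind : AffineIndependent ℝ ![V, A, B])
    (h : ∃ x ∈ segment ℝ V P, x ∈ convexHull ℝ ({V, A, B} : Set (EuclideanSpace ℝ (Fin 2))) ∧ x ≠ V) :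
    P ∈ convexHull ℝ ({V, A, B} : Set (EuclideanSpace ℝ (Fin 2))) ∨
      (segment ℝ V P ∩ segment ℝ A B).Nonempty := by
  obtain ⟨x, hxP, hxT, hxV⟩ := h
  rw [convexHull_insert (Set.insert_nonempty _ _), convexHull_pair, convexJoin_singleton_left] at hxT ⊢
  simp only [Set.mem_iUnion, exists_prop] at hxT ⊢
  obtain ⟨z, hz, hxz⟩ := hxT
  exact (mem_segment_or_mem_segment_of_ne_left hxP hxz hxV).imp
    (fun hP => ⟨z, hz, hP⟩) (fun hzP => ⟨z, hzP, hz⟩)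
end

section
/- Let [A, B] and [C, D] be two nondegenerate segments in ℝ³ (A ≠ B, C ≠ D) that are parallel, i.e., D − C = k·(B − A) for some nonzero real k. Then the infimum of the distances between points of [A, B] and points of [C, D] equals the minimum of the four endpoint-to-segment distances: min{ dist(A, [C, D]), dist(B, [C, D]), dist(C, [A, B]), dist(D, [A, B]) }, where dist(P, S) denotes the infimum of distances from the point P to points of the segment S. -/
/-- Sliding two points of codirectional segments `[A, B]` and `[C, D]` forward by a common
translation brings one of them to the far endpoint of its segment. -/
theorem exists_dist_eq_endpoint_of_mem_segment {E : Type*} [SeminormedAddCommGroup E]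
    [NormedSpace ℝ E] {A B C D p q : E} {k : ℝ} (hk : 0 < k) (h : D - C = k • (B - A))
    (hp : p ∈ segment ℝ A B) (hq : q ∈ segment ℝ C D) :
    (∃ q' ∈ segment ℝ C D, dist B q' = dist p q) ∨
      ∃ p' ∈ segment ℝ A B, dist D p' = dist p q := by
  rw [segment_eq_image'] at hp hq
  obtain ⟨s, ⟨hs0, hs1⟩, rfl⟩ := hp
  obtain ⟨t, ⟨ht0, ht1⟩, rfl⟩ := hq
  simp only [segment_eq_image', Set.exists_mem_image]
  obtain rfl : D = C + k • (B - A) := by rw [← h]; abel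
  rcases le_total (1 - s) ((1 - t) * k) with hle | hle
  · have hr : (1 - s) / k ≤ 1 - t := (div_le_iff₀ hk).2 hle
    have hr0 : 0 ≤ (1 - s) / k := div_nonneg (sub_nonneg.2 hs1) hk.le
    refine .inl ⟨t + (1 - s) / k, ⟨by linarith, by linarith⟩, ?_⟩
    rw [dist_eq_norm, dist_eq_norm]
    congr 1
    match_scalars <;> field_simp <;> ring
  · have hr0 : 0 ≤ (1 - t) * k := mul_nonneg (sub_nonneg.2 ht1) hk.le
    refine .inr ⟨s + (1 - t) * k, ⟨by linarith, by linarith⟩, ?_⟩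
    rw [dist_comm, dist_eq_norm, dist_eq_norm]
    congr 1
    module

/-- For parallel segments, the distance of any pair of points is at least the least
endpoint-to-segment distance. -/
theorem min_infDist_endpoint_le_dist_of_parallel {E : Type*} [SeminormedAddCommGroup E]
    [NormedSpace ℝ E] {A B C D p q : E} {k : ℝ} (hk : k ≠ 0) (h : D - C = k • (B - A))
    (hp : p ∈ segment ℝ A B) (hq : q ∈ segment ℝ C D) :
    min (min (Metric.infDist A (segment ℝ C D)) (Metric.infDist B (segment ℝ C D)))
      (min (Metric.infDist C (segment ℝ A B)) (Metric.infDist D (segment ℝ A B))) ≤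
      dist p q := by
  simp only [min_le_iff]
  rcases hk.lt_or_gt with hneg | hpos
  · have h' : C - D = (-k) • (B - A) := by rw [neg_smul, ← h, neg_sub]
    rw [segment_symm ℝ C D] at hq
    rcases exists_dist_eq_endpoint_of_mem_segment (neg_pos.2 hneg) h' hp hq with
      ⟨q', hq', hd⟩ | ⟨p', hp', hd⟩
    · rw [segment_symm ℝ D C] at hq'
      exact .inl (.inr (hd ▸ Metric.infDist_le_dist_of_mem hq'))
    · exact .inr (.inl (hd ▸ Metric.infDist_le_dist_of_mem hp'))
  · rcases exists_dist_eq_endpoint_of_mem_segment hpos h hp hq with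
      ⟨q', hq', hd⟩ | ⟨p', hp', hd⟩
    · exact .inl (.inr (hd ▸ Metric.infDist_le_dist_of_mem hq'))
    · exact .inr (.inr (hd ▸ Metric.infDist_le_dist_of_mem hp'))

/-- For two nondegenerate parallel segments `[A, B]` and `[C, D]` in `ℝ³`, the infimum
of distances between points of the two segments equals the minimum of the four
endpoint-to-segment distances. -/
theorem parallel_segments_dist_attained_at_endpoint
    (A B C D : EuclideanSpace ℝ (Fin 3)) (hAB : A ≠ B) (hCD : C ≠ D)
    (hpar : ∃ k : ℝ, k ≠ 0 ∧ D - C = k • (B - A)) :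
    sInf {d : ℝ | ∃ p ∈ segment ℝ A B, ∃ q ∈ segment ℝ C D, d = dist p q} =
      min (min (Metric.infDist A (segment ℝ C D)) (Metric.infDist B (segment ℝ C D)))
          (min (Metric.infDist C (segment ℝ A B)) (Metric.infDist D (segment ℝ A B))) := by
  obtain ⟨k, hk, h⟩ := hpar
  apply le_antisymm
  · have hbdd : BddBelow {d : ℝ | ∃ p ∈ segment ℝ A B, ∃ q ∈ segment ℝ C D, d = dist p q} :=
      ⟨0, by rintro _ ⟨p, -, q, -, rfl⟩; exact dist_nonneg⟩
    have hfst : ∀ p ∈ segment ℝ A B, sInf {d : ℝ | ∃ p ∈ segment ℝ A B,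
        ∃ q ∈ segment ℝ C D, d = dist p q} ≤ Metric.infDist p (segment ℝ C D) := fun p hp =>
      (Metric.le_infDist ⟨C, left_mem_segment ℝ C D⟩).2 fun q hq =>
        csInf_le hbdd ⟨p, hp, q, hq, rfl⟩
    have hsnd : ∀ q ∈ segment ℝ C D, sInf {d : ℝ | ∃ p ∈ segment ℝ A B,
        ∃ q ∈ segment ℝ C D, d = dist p q} ≤ Metric.infDist q (segment ℝ A B) := fun q hq =>
      (Metric.le_infDist ⟨A, left_mem_segment ℝ A B⟩).2 fun p hp =>
        csInf_le hbdd ⟨p, hp, q, hq, dist_comm q p⟩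
    exact le_min
      (le_min (hfst A (left_mem_segment ℝ A B)) (hfst B (right_mem_segment ℝ A B)))
      (le_min (hsnd C (left_mem_segment ℝ C D)) (hsnd D (right_mem_segment ℝ C D)))
  · refine le_csInf
      ⟨_, A, left_mem_segment ℝ A B, C, left_mem_segment ℝ C D, rfl⟩ ?_
    rintro _ ⟨p, hp, q, hq, rfl⟩
    exact min_infDist_endpoint_le_dist_of_parallel hk h hp hq
end
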